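/- arXiv:1611.08423 — 2 statements merged into one kernel-verified Lean document; each statement's English description precedes it below -/
import Mathlib

section
/- Let σ ≥ 0 and x₁, y₁, x₂, y₂ > 0. Then B_σ((x₁+x₂)/2, (y₁+y₂)/2)² ≤ B_σ(x₁, y₁) · B_σ(x₂, y₂). In particular, if x, y > 0 and a, b are real numbers with x − |a| > 0 and y − |b| > 0, then B_σ(x, y)² ≤ B_σ(x+a, y+b) · B_σ(x−a, y−b). -/
open Real intervalIntegral

/-- The extended beta function `B_σ(x, y) = ∫₀¹ t^(x-1) (1-t)^(y-1) exp(-σ/(t(1-t))) dt`. -/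
noncomputable def extBeta (σ x y : ℝ) : ℝ :=
  ∫ t in (0:ℝ)..1, t ^ (x - 1) * (1 - t) ^ (y - 1) * Real.exp (-σ / (t * (1 - t)))

/-- A Cauchy-Schwarz inequality for functions satisfying `h ^ 2 ≤ f * g` almost everywhere. -/
theorem sq_integral_le_mul_integral {α : Type*} [MeasurableSpace α] {μ : MeasureTheory.Measure α}
    {f g h : α → ℝ} (hf : MeasureTheory.Integrable f μ) (hg : MeasureTheory.Integrable g μ)
    (hh : MeasureTheory.Integrable h μ) (hf₀ : ∀ᵐ t ∂μ, 0 ≤ f t) (hg₀ : ∀ᵐ t ∂μ, 0 ≤ g t)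
    (hfg : ∀ᵐ t ∂μ, h t ^ 2 ≤ f t * g t) :
    (∫ t, h t ∂μ) ^ 2 ≤ (∫ t, f t ∂μ) * ∫ t, g t ∂μ := by
  have key : discrim (∫ t, f t ∂μ) (2 * ∫ t, h t ∂μ) (∫ t, g t ∂μ) ≤ 0 := by
    refine discrim_le_zero fun s => ?_
    have hs : (∫ t, f t ∂μ) * (s * s) + (2 * ∫ t, h t ∂μ) * s + ∫ t, g t ∂μ
        = ∫ t, (f t * (s * s) + h t * (2 * s) + g t) ∂μ := by
      have hfh : MeasureTheory.Integrable (fun t => f t * (s * s) + h t * (2 * s)) μ :=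
        (hf.mul_const _).add (hh.mul_const _)
      rw [MeasureTheory.integral_add hfh hg,
        MeasureTheory.integral_add (hf.mul_const _) (hh.mul_const _),
        MeasureTheory.integral_mul_const, MeasureTheory.integral_mul_const]
      ring
    rw [hs]
    refine MeasureTheory.integral_nonneg_of_ae ?_
    filter_upwards [hf₀, hg₀, hfg] with t h₁ h₂ h₃
    have h₄ : 0 ≤ f t * (s * s) + g t := add_nonneg (mul_nonneg h₁ (mul_self_nonneg s)) h₂
    have h₅ : (h t * (2 * s)) ^ 2 ≤ (f t * (s * s) + g t) ^ 2 := by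
      nlinarith [mul_le_mul_of_nonneg_right h₃ (sq_nonneg s), sq_nonneg (f t * (s * s) - g t)]
    have h₆ := (abs_le_of_sq_le_sq' h₅ h₄).1
    simp only [Pi.zero_apply]
    linarith
  rw [discrim] at key
  linarith

/-- The real beta integrand is integrable on `(0, 1)` for positive parameters. -/
theorem integrableOn_rpow_mul_one_sub_rpow {x y : ℝ} (hx : 0 < x) (hy : 0 < y) :
    MeasureTheory.IntegrableOn (fun t : ℝ => t ^ (x - 1) * (1 - t) ^ (y - 1)) (Set.Ioo 0 1) := by
  have h := ((intervalIntegrable_iff_integrableOn_Ioo_of_le zero_le_one).1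
    (Complex.betaIntegral_convergent (u := x) (v := y) (by simpa) (by simpa))).re
  refine MeasureTheory.IntegrableOn.congr_fun h (fun t ht => ?_) measurableSet_Ioo
  have h1 : ((t : ℂ) ^ ((x : ℂ) - 1)) = ((t ^ (x - 1) : ℝ) : ℂ) := by
    rw [Complex.ofReal_cpow ht.1.le]
    push_cast
    rfl
  have h2 : ((1 - (t : ℂ)) ^ ((y : ℂ) - 1)) = (((1 - t) ^ (y - 1) : ℝ) : ℂ) := by
    rw [Complex.ofReal_cpow (sub_nonneg.2 ht.2.le)]
    push_cast
    rfl
  simp only [h1, h2, ← Complex.ofReal_mul]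
  exact Complex.ofReal_re _

/-- The extended beta integrand is integrable on `(0, 1)` for positive parameters. -/
theorem integrableOn_extBeta {σ x y : ℝ} (hσ : 0 ≤ σ) (hx : 0 < x) (hy : 0 < y) :
    MeasureTheory.IntegrableOn
      (fun t : ℝ => t ^ (x - 1) * (1 - t) ^ (y - 1) * Real.exp (-σ / (t * (1 - t))))
      (Set.Ioo 0 1) := by
  refine (integrableOn_rpow_mul_one_sub_rpow hx hy).mul_bdd (c := 1)
    (Measurable.aestronglyMeasurable (by fun_prop)) ?_
  refine MeasureTheory.ae_restrict_of_forall_mem measurableSet_Ioo fun t ht => ?_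
  rw [Real.norm_eq_abs, Real.abs_exp, Real.exp_le_one_iff]
  exact div_nonpos_of_nonpos_of_nonneg (neg_nonpos.2 hσ)
    (mul_nonneg ht.1.le (sub_nonneg.2 ht.2.le))

theorem extBeta_eq_setIntegral (σ x y : ℝ) :
    extBeta σ x y = ∫ t in Set.Ioo (0 : ℝ) 1,
      t ^ (x - 1) * (1 - t) ^ (y - 1) * Real.exp (-σ / (t * (1 - t))) := by
  rw [extBeta, intervalIntegral.integral_of_le zero_le_one,
    MeasureTheory.integral_Ioc_eq_integral_Ioo]

theorem rpow_midpoint_sub_one_sq {t : ℝ} (ht : 0 < t) (x₁ x₂ : ℝ) :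
    (t ^ ((x₁ + x₂) / 2 - 1)) ^ 2 = t ^ (x₁ - 1) * t ^ (x₂ - 1) := by
  rw [← Real.rpow_mul_natCast ht.le, ← Real.rpow_add ht]
  congr 1
  push_cast
  ring

/-- Midpoint log-convexity of the extended beta function in both parameters jointly. -/
theorem extBeta_midpoint_sq_le {σ x₁ y₁ x₂ y₂ : ℝ} (hσ : 0 ≤ σ)
    (hx₁ : 0 < x₁) (hy₁ : 0 < y₁) (hx₂ : 0 < x₂) (hy₂ : 0 < y₂) :
    extBeta σ ((x₁ + x₂) / 2) ((y₁ + y₂) / 2) ^ 2 ≤ extBeta σ x₁ y₁ * extBeta σ x₂ y₂ := by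
  have nonneg (x y : ℝ) : ∀ t ∈ Set.Ioo (0 : ℝ) 1,
      0 ≤ t ^ (x - 1) * (1 - t) ^ (y - 1) * Real.exp (-σ / (t * (1 - t))) := fun t ht =>
    mul_nonneg (mul_nonneg (Real.rpow_nonneg ht.1.le _)
      (Real.rpow_nonneg (sub_nonneg.2 ht.2.le) _)) (Real.exp_nonneg _)
  simp only [extBeta_eq_setIntegral]
  refine sq_integral_le_mul_integral (integrableOn_extBeta hσ hx₁ hy₁)
    (integrableOn_extBeta hσ hx₂ hy₂) (integrableOn_extBeta hσ (by positivity) (by positivity))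
    (MeasureTheory.ae_restrict_of_forall_mem measurableSet_Ioo (nonneg _ _))
    (MeasureTheory.ae_restrict_of_forall_mem measurableSet_Ioo (nonneg _ _))
    (MeasureTheory.ae_restrict_of_forall_mem measurableSet_Ioo fun t ht => le_of_eq ?_)
  rw [mul_pow, mul_pow, rpow_midpoint_sub_one_sq ht.1,
    rpow_midpoint_sub_one_sq (sub_pos.2 ht.2)]
  ring

/-- Midpoint log-convexity of the extended beta function, and its Turán-type consequence. -/
theorem extBeta_midpoint (σ : ℝ) (hσ : 0 ≤ σ)
    (x₁ y₁ x₂ y₂ : ℝ) (hx₁ : 0 < x₁) (hy₁ : 0 < y₁) (hx₂ : 0 < x₂) (hy₂ : 0 < y₂) :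
    extBeta σ ((x₁ + x₂) / 2) ((y₁ + y₂) / 2) ^ 2 ≤ extBeta σ x₁ y₁ * extBeta σ x₂ y₂ ∧
    ∀ x y a b : ℝ, 0 < x - |a| → 0 < y - |b| →
      extBeta σ x y ^ 2 ≤ extBeta σ (x + a) (y + b) * extBeta σ (x - a) (y - b) := by
  refine ⟨extBeta_midpoint_sq_le hσ hx₁ hy₁ hx₂ hy₂, fun x y a b ha hb => ?_⟩
  have h := extBeta_midpoint_sq_le (x₁ := x + a) (y₁ := y + b) (x₂ := x - a) (y₂ := y - b) hσ
    (by linarith [neg_abs_le a]) (by linarith [neg_abs_le b])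
    (by linarith [le_abs_self a]) (by linarith [le_abs_self b])
  rwa [show (x + a + (x - a)) / 2 = x by ring, show (y + b + (y - b)) / 2 = y by ring] at h
end

section
/- Let σ ≥ 0, c > b > 0 and x ∈ (0, 1) be fixed. Then the function a ↦ F_σ(a, b; c; x) is log-convex on (0, ∞); in particular, for all a, a' > 0 and α ∈ [0, 1], F_σ(α a + (1−α) a', b; c; x) ≤ (F_σ(a, b; c; x))^α · (F_σ(a', b; c; x))^{1−α}. -/
open Real intervalIntegral

/-- The classical Euler beta function. -/
noncomputable def classicalBeta (u v : ℝ) : ℝ :=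
  Real.Gamma u * Real.Gamma v / Real.Gamma (u + v)

/-- The extended Gaussian hypergeometric function. -/
noncomputable def extGHF (σ a b c x : ℝ) : ℝ :=
  (1 / classicalBeta b (c - b)) *
    ∫ t in (0:ℝ)..1, t ^ (b - 1) * (1 - t) ^ (c - b - 1) * (1 - x * t) ^ (-a) *
      Real.exp (-σ / (t * (1 - t)))

open MeasureTheory Set in
/-- Hölder's inequality in geometric-mean form for Bochner integrals. -/
theorem integral_rpow_mul_rpow_le {X : Type*} [MeasurableSpace X] {μ : Measure X} {f g : X → ℝ}
    (hf : Integrable f μ) (hg : Integrable g μ) (hf0 : 0 ≤ᵐ[μ] f) (hg0 : 0 ≤ᵐ[μ] g)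
    {p q : ℝ} (hp : 0 ≤ p) (hq : 0 ≤ q) (hpq : p + q = 1) :
    ∫ t, f t ^ p * g t ^ q ∂μ ≤ (∫ t, f t ∂μ) ^ p * (∫ t, g t ∂μ) ^ q := by
  have hIf : 0 ≤ ∫ t, f t ∂μ := integral_nonneg_of_ae hf0
  have hIg : 0 ≤ ∫ t, g t ∂μ := integral_nonneg_of_ae hg0
  have key := ENNReal.lintegral_mul_norm_pow_le (μ := μ)
    hf.aemeasurable.ennreal_ofReal hg.aemeasurable.ennreal_ofReal hp hq hpq
  rw [← ofReal_integral_eq_lintegral_ofReal hf hf0, ← ofReal_integral_eq_lintegral_ofReal hg hg0,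
    ENNReal.ofReal_rpow_of_nonneg hIf hp, ENNReal.ofReal_rpow_of_nonneg hIg hq,
    ← ENNReal.ofReal_mul (by positivity)] at key
  have hnonneg : 0 ≤ᵐ[μ] fun t => f t ^ p * g t ^ q := by
    filter_upwards [hf0, hg0] with t h1 h2
    exact mul_nonneg (rpow_nonneg h1 _) (rpow_nonneg h2 _)
  rw [integral_eq_lintegral_of_nonneg_ae hnonneg
    ((hf.aemeasurable.pow_const p).mul (hg.aemeasurable.pow_const q)).aestronglyMeasurable]
  refine ENNReal.toReal_le_of_le_ofReal (by positivity) (le_of_eq_of_le ?_ key)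
  refine lintegral_congr_ae ?_
  filter_upwards [hf0, hg0] with t h1 h2
  rw [ENNReal.ofReal_mul (rpow_nonneg h1 _), ENNReal.ofReal_rpow_of_nonneg h1 hp,
    ENNReal.ofReal_rpow_of_nonneg h2 hq]

open MeasureTheory Set in
theorem integrableOn_rpow_mul_one_sub_rpow_s18 {u v : ℝ} (hu : 0 < u) (hv : 0 < v) :
    IntegrableOn (fun t : ℝ => t ^ (u - 1) * (1 - t) ^ (v - 1)) (Ioo 0 1) := by
  have h := Complex.betaIntegral_convergent (u := (u : ℂ)) (v := (v : ℂ)) (by simpa) (by simpa)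
  rw [intervalIntegrable_iff_integrableOn_Ioo_of_le zero_le_one] at h
  refine h.norm.congr ?_
  filter_upwards [ae_restrict_mem measurableSet_Ioo] with t ht
  have h1 : 0 < 1 - t := sub_pos.2 ht.2
  rw [norm_mul, ← Complex.ofReal_one, ← Complex.ofReal_sub, ← Complex.ofReal_sub,
    ← Complex.ofReal_sub, Complex.norm_cpow_eq_rpow_re_of_pos ht.1,
    Complex.norm_cpow_eq_rpow_re_of_pos h1, Complex.ofReal_re, Complex.ofReal_re]

open MeasureTheory Set in
theorem integrableOn_extGHF_integrand {σ b c x a : ℝ} (hσ : 0 ≤ σ) (hb : 0 < b) (hbc : b < c)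
    (hx : x ∈ Ioo (0 : ℝ) 1) (ha : 0 < a) :
    IntegrableOn (fun t : ℝ => t ^ (b - 1) * (1 - t) ^ (c - b - 1) * (1 - x * t) ^ (-a) *
      Real.exp (-σ / (t * (1 - t)))) (Ioo 0 1) := by
  simp_rw [mul_assoc (_ * _) (_ ^ (-a)) _]
  refine (integrableOn_rpow_mul_one_sub_rpow_s18 hb (sub_pos.2 hbc)).mul_bdd (c := (1 - x) ^ (-a))
    (by fun_prop) ?_
  filter_upwards [ae_restrict_mem measurableSet_Ioo] with t ht
  have h1 : 0 < 1 - t := sub_pos.2 ht.2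
  have hx1 : 0 < 1 - x := sub_pos.2 hx.2
  have hxt : 1 - x ≤ 1 - x * t := by nlinarith [hx.1, ht.2]
  have hxt0 : 0 < 1 - x * t := hx1.trans_le hxt
  have hexp : Real.exp (-σ / (t * (1 - t))) ≤ 1 :=
    Real.exp_le_one_iff.2 (div_nonpos_of_nonpos_of_nonneg (neg_nonpos.2 hσ)
      (mul_pos ht.1 h1).le)
  rw [Real.norm_of_nonneg (by positivity)]
  exact (mul_le_of_le_one_right (by positivity) hexp).trans
    (Real.rpow_le_rpow_of_nonpos hx1 hxt (neg_nonpos.2 ha.le))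

/-- For fixed σ, b, c, x, a ↦ F_σ(a, b; c; x) is log-convex on (0, ∞). -/
theorem extGHF_logConvex_in_a (σ b c x : ℝ) (hσ : 0 ≤ σ) (hb : 0 < b) (hbc : b < c)
    (hx : x ∈ Set.Ioo (0:ℝ) 1) :
    ∀ a a' α : ℝ, 0 < a → 0 < a' → α ∈ Set.Icc (0:ℝ) 1 →
      extGHF σ (α * a + (1 - α) * a') b c x ≤
        extGHF σ a b c x ^ α * extGHF σ a' b c x ^ (1 - α) := by
  intro a a' α ha ha' hα
  have hq : 0 ≤ 1 - α := sub_nonneg.2 hα.2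
  have hB : 0 < 1 / classicalBeta b (c - b) := by
    have h1 := Real.Gamma_pos_of_pos hb
    have h2 := Real.Gamma_pos_of_pos (sub_pos.2 hbc)
    have h3 := Real.Gamma_pos_of_pos (add_pos hb (sub_pos.2 hbc))
    unfold classicalBeta
    positivity
  have hpos : ∀ t ∈ Set.Ioo (0 : ℝ) 1, 0 < 1 - t ∧ 0 < 1 - x * t := fun t ht =>
    ⟨sub_pos.2 ht.2, by nlinarith [hx.1, hx.2, ht.1, ht.2]⟩
  have hnonneg : ∀ s : ℝ, 0 ≤ᵐ[MeasureTheory.volume.restrict (Set.Ioo 0 1)] fun t : ℝ =>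
      t ^ (b - 1) * (1 - t) ^ (c - b - 1) * (1 - x * t) ^ (-s) *
        Real.exp (-σ / (t * (1 - t))) := fun s => by
    filter_upwards [MeasureTheory.ae_restrict_mem measurableSet_Ioo] with t ht
    obtain ⟨h1, h2⟩ := hpos t ht
    have h0 := ht.1
    simp only [Pi.zero_apply]
    positivity
  have key := integral_rpow_mul_rpow_le (integrableOn_extGHF_integrand hσ hb hbc hx ha)
    (integrableOn_extGHF_integrand hσ hb hbc hx ha') (hnonneg a) (hnonneg a') hα.1 hq
    (add_sub_cancel α 1)
  have hI := MeasureTheory.integral_nonneg_of_ae (hnonneg a)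
  have hI' := MeasureTheory.integral_nonneg_of_ae (hnonneg a')
  simp only [extGHF, integral_of_le zero_le_one, MeasureTheory.integral_Ioc_eq_integral_Ioo]
  rw [Real.mul_rpow hB.le hI, Real.mul_rpow hB.le hI', mul_mul_mul_comm, ← Real.rpow_add hB,
    add_sub_cancel, Real.rpow_one]
  refine mul_le_mul_of_nonneg_left (le_of_eq_of_le ?_ key) hB.le
  refine MeasureTheory.setIntegral_congr_fun measurableSet_Ioo fun t ht => ?_
  obtain ⟨h1, h2⟩ := hpos t ht
  have h0 := ht.1
  have hw : 0 < t ^ (b - 1) * (1 - t) ^ (c - b - 1) * Real.exp (-σ / (t * (1 - t))) := by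
    positivity
  simp only [mul_right_comm (t ^ (b - 1) * (1 - t) ^ (c - b - 1)) _ (Real.exp _)]
  rw [Real.mul_rpow hw.le (by positivity), Real.mul_rpow hw.le (by positivity), mul_mul_mul_comm,
    ← Real.rpow_add hw, add_sub_cancel, Real.rpow_one, ← Real.rpow_mul h2.le,
    ← Real.rpow_mul h2.le, ← Real.rpow_add h2]
  ring_nf
end
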